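/- Let k be a field and n, m ≥ 1. Let V^m be the k-vector space with basis v_1, …, v_m and let T^n(V^m) be its n-th tensor power, with basis the words v_{f(1)} ⊗ ⋯ ⊗ v_{f(n)} indexed by functions f : {1,…,n} → {1,…,m}. For 1 ≤ i ≤ m let ∂^i : V^{m−1} → V^m be the linear map defined on basis vectors by ∂^i(v_j) = v_j for j < i, ∂^i(v_i) = v_i + v_{i+1}, and ∂^i(v_j) = v_{j+1} for j > i, and let T^n(∂^i) : T^n(V^{m−1}) → T^n(V^m) be the induced map on n-th tensor powers. Then the quotient vector space T^n(V^m) / (Σ_{i=1}^{m} Image(T^n(∂^i))) has dimension equal to the number of surjective functions from {1,…,n} onto {1,…,m}. In particular it is zero when m > n, and has dimension n! when m = n. -/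

import Mathlib

/-- The coface map `∂ⁱ : Vᵐ → Vᵐ⁺¹` (for `0 ≤ i ≤ m+1`) on the vector space
`Vᵐ = Fin m → k` with basis `v₁, …, v_m` (the basis vector `v_{j+1}` being the
`j`-th standard basis vector of `Fin m → k`).  In the 1-indexed notation of the
paper: `∂ⁱ(v_j) = v_j` for `j < i`, `∂ⁱ(v_i) = v_i + v_{i+1}`, and
`∂ⁱ(v_j) = v_{j+1}` for `j > i`. -/
noncomputable def coface (k : Type*) [Field k] (m i : ℕ) :
    (Fin m → k) →ₗ[k] (Fin (m + 1) → k) :=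
  (Pi.basisFun k (Fin m)).constr ℕ fun j =>
    if (j : ℕ) + 1 < i then Pi.single (Fin.castSucc j) 1
    else if (j : ℕ) + 1 = i then Pi.single (Fin.castSucc j) 1 + Pi.single j.succ 1
    else Pi.single j.succ 1

open Module

/-- The prefix sum `v₁ + ⋯ + v_{j+1}` of standard basis vectors. -/
def prefixSum (k : Type*) [Field k] (m : ℕ) (j : Fin m) : Fin m → k :=
  fun l => if l ≤ j then 1 else 0

theorem prefixSum_zero (k : Type*) [Field k] (m : ℕ) :
    prefixSum k (m + 1) 0 = Pi.single 0 1 := by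
  ext l
  simp [prefixSum, Pi.single_apply]

theorem prefixSum_succ (k : Type*) [Field k] (m : ℕ) (j : Fin m) :
    prefixSum k (m + 1) j.succ = prefixSum k (m + 1) j.castSucc + Pi.single j.succ 1 := by
  ext l
  simp only [prefixSum, Pi.add_apply, Pi.single_apply, Fin.le_def, Fin.ext_iff, Fin.val_succ,
    Fin.val_castSucc]
  split_ifs <;> first | omega | simp

theorem top_le_span_prefixSum (k : Type*) [Field k] (m : ℕ) :
    ⊤ ≤ Submodule.span k (Set.range (prefixSum k m)) := by
  rw [← (Pi.basisFun k (Fin m)).span_eq, Submodule.span_le]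
  rintro _ ⟨j, rfl⟩
  rw [Pi.basisFun_apply, SetLike.mem_coe]
  cases m with
  | zero => exact j.elim0
  | succ m =>
    have mem (j) : prefixSum k (m + 1) j ∈ Submodule.span k (Set.range (prefixSum k (m + 1))) :=
      Submodule.subset_span ⟨j, rfl⟩
    cases j using Fin.cases with
    | zero => exact prefixSum_zero k m ▸ mem 0
    | succ j =>
      rw [← sub_eq_of_eq_add' (prefixSum_succ k m j)]
      exact sub_mem (mem _) (mem _)

/-- The basis of `Fin m → k` consisting of the prefix sums of the standard basis. -/
noncomputable def prefixBasis (k : Type*) [Field k] (m : ℕ) : Basis (Fin m) k (Fin m → k) :=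
  basisOfTopLeSpanOfCardEqFinrank (prefixSum k m) (top_le_span_prefixSum k m) (by simp)

theorem prefixBasis_apply (k : Type*) [Field k] (m : ℕ) (j : Fin m) :
    prefixBasis k m j = prefixSum k m j := by
  simp [prefixBasis]

theorem coface_single (k : Type*) [Field k] (m i : ℕ) (j : Fin m) :
    coface k m i (Pi.single j 1) =
      if (j : ℕ) + 1 < i then Pi.single (Fin.castSucc j) 1
      else if (j : ℕ) + 1 = i then Pi.single (Fin.castSucc j) 1 + Pi.single j.succ 1
      else Pi.single j.succ 1 := by
  rw [← Pi.basisFun_apply, coface, Basis.constr_basis]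

/-- In the basis of prefix sums, a coface map just skips a basis vector. -/
theorem coface_prefixSum (k : Type*) [Field k] (m : ℕ) (i : Fin (m + 1)) (j : Fin m) :
    coface k m (i + 1) (prefixSum k m j) = prefixSum k (m + 1) (i.succAbove j) := by
  cases m with
  | zero => exact j.elim0
  | succ m =>
    induction j using Fin.induction with
    | zero =>
      rw [prefixSum_zero, coface_single]
      split_ifs <;> ext l <;>
        simp only [Fin.succAbove, prefixSum, Fin.lt_def, Fin.le_def, Pi.add_apply, Pi.single_apply,
          Fin.ext_iff, Fin.val_succ, Fin.val_castSucc, Fin.val_zero] at * <;>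
        split_ifs <;> simp only [Fin.val_succ, Fin.val_castSucc, Fin.val_zero] at * <;>
        first | omega | simp
    | succ j ih =>
      rw [prefixSum_succ, map_add, ih, coface_single]
      ext l
      simp only [Fin.succAbove, prefixSum, Fin.lt_def, Fin.le_def, Fin.val_castSucc, Fin.val_succ,
        Pi.add_apply]
      split_ifs <;> first
        | omega
        | simp only [Pi.add_apply, Pi.single_apply, Fin.ext_iff, Fin.val_succ, Fin.val_castSucc] at *
          split_ifs <;> first | omega | simp

/-- The basis of the `n`-th tensor power given by words in the prefix sums. -/
noncomputable def wordBasis (k : Type*) [Field k] (n m : ℕ) :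
    Basis (Fin n → Fin m) k (PiTensorProduct k fun _ : Fin n => (Fin m → k)) :=
  Basis.piTensorProduct fun _ => prefixBasis k m

theorem map_coface_wordBasis (k : Type*) [Field k] (n m : ℕ) (i : Fin (m + 1))
    (f : Fin n → Fin m) :
    PiTensorProduct.map (fun _ : Fin n => coface k m (i + 1)) (wordBasis k n m f) =
      wordBasis k n (m + 1) (i.succAbove ∘ f) := by
  simp [wordBasis, Basis.piTensorProduct_apply, PiTensorProduct.map_tprod, prefixBasis_apply,
    coface_prefixSum]

theorem range_map_coface (k : Type*) [Field k] (n m : ℕ) (i : Fin (m + 1)) :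
    LinearMap.range (PiTensorProduct.map fun _ : Fin n => coface k m (i + 1)) =
      Submodule.span k (wordBasis k n (m + 1) '' {f | i ∉ Set.range f}) := by
  rw [LinearMap.range_eq_map, ← (wordBasis k n m).span_eq, Submodule.map_span, ← Set.range_comp]
  congr 1
  ext x
  constructor
  · rintro ⟨f, rfl⟩
    refine ⟨i.succAbove ∘ f, ?_, (map_coface_wordBasis k n m i f).symm⟩
    rintro ⟨a, ha⟩
    exact Fin.succAbove_ne i (f a) ha
  · rintro ⟨f, hf, rfl⟩
    choose g hg using fun a => Fin.exists_succAbove_eq (x := f a) (y := i) fun h => hf ⟨a, h⟩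
    refine ⟨g, (map_coface_wordBasis k n m i g).trans ?_⟩
    congr 1
    exact funext hg

/-- The sum of the images of the positive cofaces is spanned by the non-surjective words. -/
theorem iSup_range_map_coface (k : Type*) [Field k] (n m : ℕ) :
    (⨆ i ∈ Finset.Icc 1 (m + 1),
      LinearMap.range (PiTensorProduct.map fun _ : Fin n => coface k m i)) =
      Submodule.span k (Set.range (wordBasis k n (m + 1) ∘
        (Subtype.val : {f : Fin n → Fin (m + 1) // ¬ Function.Surjective f} → _))) := by
  apply le_antisymm
  · refine iSup₂_le fun i hi => ?_
    obtain ⟨h1, h2⟩ := Finset.mem_Icc.mp hi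
    obtain ⟨i, rfl⟩ := Nat.exists_eq_add_of_le' h1
    refine (range_map_coface k n m ⟨i, by omega⟩).trans_le (Submodule.span_mono ?_)
    rintro _ ⟨f, hf, rfl⟩
    exact ⟨⟨f, fun h => hf (h _)⟩, rfl⟩
  · rw [Submodule.span_le]
    rintro _ ⟨⟨f, hf⟩, rfl⟩
    obtain ⟨i, hi⟩ := not_forall.mp hf
    refine Submodule.mem_iSup_of_mem (i + 1 : ℕ) (Submodule.mem_iSup_of_mem ?_ ?_)
    · exact Finset.mem_Icc.mpr ⟨by omega, by omega⟩
    · rw [range_map_coface]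
      exact Submodule.subset_span ⟨f, hi, rfl⟩

theorem finrank_quotient_iSup_range_map_coface (k : Type*) [Field k] (n m : ℕ) :
    finrank k
        ((PiTensorProduct k fun _ : Fin n => (Fin (m + 1) → k)) ⧸
          ⨆ i ∈ Finset.Icc 1 (m + 1),
            LinearMap.range (PiTensorProduct.map fun _ : Fin n => coface k m i)) =
      Nat.card {f : Fin n → Fin (m + 1) // Function.Surjective f} := by
  classical
  have := Module.Finite.of_basis (wordBasis k n (m + 1))
  rw [iSup_range_map_coface, Submodule.finrank_quotient, finrank_span_eq_card
    ((wordBasis k n (m + 1)).linearIndependent.comp _ Subtype.val_injective),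
    finrank_eq_card_basis (wordBasis k n (m + 1)), Fintype.card_subtype_compl,
    Nat.card_eq_fintype_card]
  exact Nat.sub_sub_self (Fintype.card_subtype_le _)

/-- Let `k` be a field and `n ≥ 1`, `m ≥ 1` (here written as
`m + 1` with `m : ℕ` arbitrary).  The quotient of the `n`-th tensor power
`Tⁿ(Vᵐ⁺¹)` of the `(m+1)`-dimensional space `Vᵐ⁺¹` by the sum of the images of
the induced coface maps `Tⁿ(∂ⁱ) : Tⁿ(Vᵐ) → Tⁿ(Vᵐ⁺¹)`, `1 ≤ i ≤ m + 1`, has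
dimension the number of surjections `{1,…,n} ↠ {1,…,m+1}`.  In particular it is
zero when `m + 1 > n` and has dimension `n!` when `m + 1 = n`. -/
theorem normalized_tensor_power_dim (k : Type) [Field k] (n m : ℕ) (hn : 1 ≤ n) :
    Module.finrank k
        ((PiTensorProduct k fun _ : Fin n => (Fin (m + 1) → k)) ⧸
          ⨆ i ∈ Finset.Icc 1 (m + 1),
            LinearMap.range (PiTensorProduct.map fun _ : Fin n => coface k m i)) =
      Nat.card {f : Fin n → Fin (m + 1) // Function.Surjective f} ∧
    (m + 1 > n →
      Subsingleton
        ((PiTensorProduct k fun _ : Fin n => (Fin (m + 1) → k)) ⧸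
          ⨆ i ∈ Finset.Icc 1 (m + 1),
            LinearMap.range (PiTensorProduct.map fun _ : Fin n => coface k m i))) ∧
    (m + 1 = n →
      Module.finrank k
          ((PiTensorProduct k fun _ : Fin n => (Fin (m + 1) → k)) ⧸
            ⨆ i ∈ Finset.Icc 1 (m + 1),
              LinearMap.range (PiTensorProduct.map fun _ : Fin n => coface k m i)) =
        Nat.factorial n) := by
  have h := finrank_quotient_iSup_range_map_coface k n m
  have := Module.Finite.of_basis (wordBasis k n (m + 1))
  refine ⟨h, fun hmn => ?_, fun hmn => ?_⟩
  · rw [← finrank_zero_iff (R := k), h, Nat.card_eq_zero]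
    refine Or.inl ⟨fun ⟨f, hf⟩ => ?_⟩
    have := Fintype.card_le_of_surjective f hf
    simp only [Fintype.card_fin] at this
    omega
  · subst hmn
    rw [h, Nat.card_congr (Equiv.subtypeEquivRight fun f =>
      Finite.injective_iff_surjective.symm.trans Finite.injective_iff_bijective),
      Nat.card_congr Equiv.bijectiveEquiv, Nat.card_perm, Nat.card_fin]
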